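/- a_p(k)/p ≡ −(1/(k−1)!)^{n−2} · (1/(2k)!) (mod p), i.e. the p-adic valuation of the rational number a_p(k)/p + 1/((k−1)!^{n−2}·(2k)!) is at least 1, where a_p(k) is the coefficient of t in the minimal polynomial over ℚ of θ_k = Σ_{y∈U_k} (ζ_p^y − 1). -/

import Mathlib

theorem ZMod.exists_isPrimitiveRoot {p k : ℕ} [Fact p.Prime] (hkd : k ∣ p - 1) :
    ∃ g : ZMod p, IsPrimitiveRoot g k := by
  obtain ⟨m, hm⟩ := hkd
  have hp1 : 0 < p - 1 := Nat.sub_pos_of_lt (Fact.out : p.Prime).one_lt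
  obtain ⟨g, hg⟩ := IsCyclic.exists_ofOrder_eq_natCard (α := (ZMod p)ˣ)
  rw [Nat.card_eq_fintype_card, ZMod.card_units] at hg
  have h := (IsPrimitiveRoot.orderOf g).pow (by rw [hg]; exact hp1) (a := m) (b := k)
    (by rw [hg, hm, mul_comm])
  exact ⟨_, h.map_of_injective (f := Units.coeHom (ZMod p)) Units.val_injective⟩

open Finset Polynomial in
theorem ZMod.sum_pow_roots_of_unity {p k : ℕ} [Fact p.Prime] (hk : 0 < k) (hkd : k ∣ p - 1)
    (i : ℕ) :
    ∑ y ∈ univ.filter (fun y : ZMod p => y ^ k = 1), y ^ i = if k ∣ i then (k : ZMod p) else 0 := by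
  obtain ⟨g, hg⟩ := ZMod.exists_isPrimitiveRoot hkd
  split_ifs with h
  · obtain ⟨m, rfl⟩ := h
    have : univ.filter (fun y : ZMod p => y ^ k = 1) = nthRootsFinset k (1 : ZMod p) := by
      ext y; simp [mem_nthRootsFinset hk]
    rw [sum_congr rfl (g := fun _ => 1) (fun y hy => by
      rw [pow_mul, (mem_filter.1 hy).2, one_pow]), this]
    simp [hg.card_nthRootsFinset]
  · have hg0 : g ≠ 0 := hg.ne_zero hk.ne'
    have key : ∑ y ∈ univ.filter (fun y : ZMod p => y ^ k = 1), (g * y) ^ i =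
        ∑ y ∈ univ.filter (fun y : ZMod p => y ^ k = 1), y ^ i :=
      sum_bijective (g * ·) (mulLeft_bijective₀ g hg0) (fun y => by
        simp [mul_pow, hg.pow_eq_one]) (fun _ _ => rfl)
    simp_rw [mul_pow, ← mul_sum] at key
    have hgi : g ^ i - 1 ≠ 0 := fun h' => h ((hg.pow_eq_one_iff_dvd i).1 (sub_eq_zero.1 h'))
    exact (mul_eq_zero.1 (show (g ^ i - 1) * _ = 0 by rw [sub_mul, key]; simp)).resolve_left hgi

open Finset Polynomial in
/-- Sums of binomial coefficients over a coset `c • U_k`, modulo `p`. -/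
theorem ZMod.exists_sum_choose_coset_eq {p k : ℕ} [Fact p.Prime] (hk : 0 < k) (hkd : k ∣ p - 1)
    (hk2 : 2 * k < p) :
    ∃ α : ℕ → ZMod p, α k = ((k - 1).factorial : ZMod p)⁻¹ ∧ (∀ j < k, α j = 0) ∧
      ∀ (c : ZMod p) (j : ℕ), 1 ≤ j → j ≤ 2 * k →
        ∑ y ∈ univ.filter (fun y : ZMod p => y ^ k = 1), (((c * y).val.choose j : ℕ) : ZMod p) =
          c ^ k * α j + if j = 2 * k then c ^ (2 * k) * (k * ((2 * k).factorial : ZMod p)⁻¹)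
            else 0 := by
  have hfac {j : ℕ} (hj : j < p) : (j.factorial : ZMod p) ≠ 0 := by
    rw [Ne, ZMod.natCast_eq_zero_iff, (Fact.out : p.Prime).dvd_factorial]
    exact hj.not_ge
  have hk0 : (k : ZMod p) ≠ 0 := by
    rw [Ne, ZMod.natCast_eq_zero_iff]
    exact fun h => (Nat.le_of_dvd hk h).not_gt (by lia)
  let q (j : ℕ) := descPochhammer (ZMod p) j
  have hdeg (j : ℕ) : (q j).natDegree = j := descPochhammer_natDegree _ j
  have hlead (j : ℕ) : (q j).coeff j = 1 := by
    have := (monic_descPochhammer (ZMod p) j).coeff_natDegree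
    rwa [hdeg] at this
  have hzero {i j : ℕ} (h : j < i) : (q j).coeff i = 0 :=
    coeff_eq_zero_of_natDegree_lt (by rwa [hdeg])
  refine ⟨fun j => k * (q j).coeff k * (j.factorial : ZMod p)⁻¹, ?_, ?_, ?_⟩
  · simp only [hlead, mul_one]
    obtain ⟨m, rfl⟩ : ∃ m, k = m + 1 := ⟨k - 1, by lia⟩
    rw [Nat.factorial_succ, Nat.add_sub_cancel]
    push_cast at hk0 ⊢
    rw [mul_inv, ← mul_assoc, mul_inv_cancel₀ hk0, one_mul]
  · intro j hj
    simp [hzero hj]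
  · intro c j hj1 hj2
    have hchoose (y : ZMod p) : (((y.val).choose j : ℕ) : ZMod p) =
        (∑ i ∈ range (2 * k + 1), (q j).coeff i * y ^ i) * (j.factorial : ZMod p)⁻¹ := by
      rw [← eval_eq_sum_range' (by rw [hdeg]; lia)]
      nth_rw 2 [← ZMod.natCast_zmod_val y]
      rw [descPochhammer_eval_eq_descFactorial, Nat.descFactorial_eq_factorial_mul_choose]
      push_cast
      field_simp [hfac (show j < p by lia)]
    have h0 : (q j).coeff 0 = 0 := by
      rw [coeff_zero_eq_eval_zero, descPochhammer_ne_zero_eval_zero _ (by lia)]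
    simp_rw [hchoose, ← sum_mul]
    rw [sum_comm]
    simp_rw [mul_pow, ← mul_sum, ZMod.sum_pow_roots_of_unity hk hkd]
    have hsub : ({k, 2 * k} : Finset ℕ) ⊆ range (2 * k + 1) := by
      intro i hi
      simp only [mem_insert, mem_singleton] at hi
      exact mem_range.2 (by lia)
    rw [← sum_subset hsub, sum_pair (by lia)]
    · rw [if_pos dvd_rfl, if_pos (Dvd.intro_left 2 rfl)]
      split_ifs with h
      · subst h
        rw [hlead]; ring
      · rw [hzero (show j < 2 * k by lia)]; ring
    · intro i hi hi'
      simp only [mem_insert, mem_singleton, not_or, mem_range] at hi hi'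
      split_ifs with h
      · obtain ⟨m, rfl⟩ := h
        have : m = 0 := by
          have : m < 3 := by nlinarith
          interval_cases m <;> lia
        subst this
        simp [h0]
      · simp

open Finset in
theorem one_add_pow_sub_one_eq_sum_Ico {R : Type*} [CommRing R] (π : R) {v N : ℕ} (hv : v < N) :
    (1 + π) ^ v - 1 = ∑ j ∈ Ico 1 N, (v.choose j : R) * π ^ j := by
  have h : (1 + π) ^ v = ∑ j ∈ range N, (v.choose j : R) * π ^ j := by
    rw [add_comm, add_pow]
    refine (sum_congr rfl fun j _ => ?_).trans
      (sum_subset (range_subset_range.2 hv) fun j _ hj => ?_)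
    · rw [one_pow, mul_one, mul_comm]
    · rw [Nat.choose_eq_zero_of_lt (by simpa using hj)]
      simp
  rw [h, range_eq_Ico, sum_eq_sum_Ico_succ_bot (by lia)]
  simp

/-- If `p ϖ = 0`, then `m ϖ` depends only on `m` modulo `p`. -/
theorem intCast_mul_eq_of_zmod_eq {R : Type*} [CommRing R] {p : ℕ} {ϖ : R} (hp : (p : R) * ϖ = 0)
    {m m' : ℤ} (h : (m : ZMod p) = m') : (m : R) * ϖ = m' * ϖ := by
  obtain ⟨t, ht⟩ := (ZMod.intCast_eq_intCast_iff_dvd_sub m m' p).1 h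
  have : (m' : R) - m = p * t := by exact_mod_cast congrArg (Int.cast (R := R)) ht
  linear_combination (-ϖ) * this - t * hp

open Finset in
/-- The expansion of Gaussian periods in powers of `π = ζ - 1` to relative precision `π ^ (k + 1)`. -/
theorem exists_gaussPeriod_expansion {p k : ℕ} [Fact p.Prime] (hk : 0 < k) (hkd : k ∣ p - 1)
    (hk2 : 2 * k < p) {R : Type*} [CommRing R] {π : R} (hπ : π ^ p ∣ p * π) {a b : ℤ}
    (ha : (a : ZMod p) = ((k - 1).factorial : ZMod p)⁻¹)
    (hb : (b : ZMod p) = k * ((2 * k).factorial : ZMod p)⁻¹) :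
    ∃ A : R, π ∣ A - a ∧ ∀ (c : ZMod p) (z : ℤ), (z : ZMod p) = c ^ k →
      ∃ w, ∑ y ∈ univ.filter (fun y : ZMod p => y ^ k = 1), ((1 + π) ^ (c * y).val - 1) =
        π ^ k * (z * A + z ^ 2 * b * π ^ k + π ^ (k + 1) * w) := by
  obtain ⟨α, hαk, hα0, hα⟩ := ZMod.exists_sum_choose_coset_eq hk hkd hk2
  choose e he using ZMod.intCast_surjective (n := p)
  let e' (j : ℕ) : ℤ := if j = k then a else e (α j)
  have he' (j : ℕ) : (e' j : ZMod p) = α j := by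
    simp only [e']
    split_ifs with h
    · rw [h, ha, hαk]
    · exact he _
  refine ⟨∑ j ∈ Ico k (2 * k + 1), (e' j : R) * π ^ (j - k), ?_, fun c z hz => ?_⟩
  · rw [sum_eq_sum_Ico_succ_bot (by lia)]
    simp only [e', if_pos, Nat.sub_self, pow_zero, mul_one, add_sub_cancel_left]
    exact dvd_sum fun j hj => (dvd_pow_self π (by simp at hj; lia)).mul_left _
  suffices h : π ^ (2 * k + 1) ∣
      ∑ y ∈ univ.filter (fun y : ZMod p => y ^ k = 1), ((1 + π) ^ (c * y).val - 1) -
        π ^ k * (z * (∑ j ∈ Ico k (2 * k + 1), (e' j : R) * π ^ (j - k)) + z ^ 2 * b * π ^ k) by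
    obtain ⟨w, hw⟩ := h
    exact ⟨w, by rw [sub_eq_iff_eq_add.1 hw]; ring⟩
  rw [← Ideal.mem_span_singleton, ← Ideal.Quotient.eq_zero_iff_mem]
  let f := Ideal.Quotient.mk (Ideal.span {π ^ (2 * k + 1)})
  change f _ = 0
  have hf0 : f π ^ (2 * k + 1) = 0 := by
    rw [← map_pow]
    exact Ideal.Quotient.eq_zero_iff_mem.2 (Ideal.mem_span_singleton_self _)
  have hfp : (p : R ⧸ Ideal.span {π ^ (2 * k + 1)}) * f π = 0 := by
    have : f (p * π) = 0 := Ideal.Quotient.eq_zero_iff_mem.2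
      (Ideal.mem_span_singleton.2 ((pow_dvd_pow π (by lia)).trans hπ))
    simpa using this
  simp only [map_sub, map_sum, map_mul, map_add, map_pow, map_one, map_intCast]
  generalize f π = ϖ at *
  have hfp' {j : ℕ} (hj : 1 ≤ j) : (p : R ⧸ Ideal.span {π ^ (2 * k + 1)}) * ϖ ^ j = 0 := by
    obtain ⟨i, rfl⟩ := Nat.exists_eq_add_of_le' hj
    rw [pow_succ' ϖ i, ← mul_assoc, hfp, zero_mul]
  have hexp : ∑ y ∈ univ.filter (fun y : ZMod p => y ^ k = 1), ((1 + ϖ) ^ (c * y).val - 1) =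
      ∑ j ∈ Ico 1 (2 * k + 1),
        ((∑ y ∈ univ.filter (fun y : ZMod p => y ^ k = 1), ((c * y).val.choose j : ℤ) : ℤ) :
          R ⧸ Ideal.span {π ^ (2 * k + 1)}) * ϖ ^ j := by
    simp_rw [one_add_pow_sub_one_eq_sum_Ico ϖ (ZMod.val_lt _)]
    rw [sum_comm]
    push_cast
    simp_rw [sum_mul]
    symm
    refine sum_subset (Ico_subset_Ico_right (by lia)) fun j hj hj' => ?_
    rw [mem_Ico] at hj hj'
    have : ϖ ^ j = 0 := pow_eq_zero_of_le (by lia) hf0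
    simp [this]
  have hterm {j : ℕ} (hj : j ∈ Ico 1 (2 * k + 1)) :
      ((∑ y ∈ univ.filter (fun y : ZMod p => y ^ k = 1), ((c * y).val.choose j : ℤ) : ℤ) :
          R ⧸ Ideal.span {π ^ (2 * k + 1)}) * ϖ ^ j =
        ((if k ≤ j then z * e' j else 0) + (if j = 2 * k then z ^ 2 * b else 0) : ℤ) * ϖ ^ j := by
    rw [mem_Ico] at hj
    refine intCast_mul_eq_of_zmod_eq (hfp' hj.1) ?_
    push_cast
    rw [hα c j hj.1 (by lia), he', hz, hb]
    split_ifs with h1 h2 h2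
    · ring
    · lia
    · ring
    · rw [hα0 j (by lia), mul_zero]
  rw [hexp, sum_congr rfl fun j hj => hterm hj]
  push_cast
  simp_rw [add_mul, sum_add_distrib, ite_mul, zero_mul]
  rw [sum_ite_eq' (Ico 1 (2 * k + 1)) (2 * k), if_pos (by simp; lia), ← sum_filter]
  have hfil : (Ico 1 (2 * k + 1)).filter (k ≤ ·) = Ico k (2 * k + 1) := by
    ext j; simp only [mem_filter, mem_Ico]; lia
  have hshift : ∑ j ∈ Ico k (2 * k + 1), (z : R ⧸ Ideal.span {π ^ (2 * k + 1)}) * e' j * ϖ ^ j =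
      ϖ ^ k * (z * ∑ j ∈ Ico k (2 * k + 1),
        (e' j : R ⧸ Ideal.span {π ^ (2 * k + 1)}) * ϖ ^ (j - k)) := by
    rw [mul_sum, mul_sum]
    refine sum_congr rfl fun j hj => ?_
    rw [mem_Ico] at hj
    have : ϖ ^ j = ϖ ^ k * ϖ ^ (j - k) := by rw [← pow_add ϖ, Nat.add_sub_cancel' hj.1]
    rw [this]
    ring
  rw [hfil, hshift]
  ring

open Finset Polynomial in
theorem dvd_coeff_of_root_eq_pow_mul {R : Type*} [CommRing R] [IsDomain R] {π : R} (hπ0 : π ≠ 0)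
    {p k n : ℕ} [Fact p.Prime] (hk : 0 < k) (hp : π ^ (k * n) ∣ (p : R))
    (hπp : ∀ N : ℤ, π ∣ (N : R) → (p : ℤ) ∣ N) {T : R} {t : ℤ} (hT : π ∣ T - t)
    (ht : ¬ (p : ℤ) ∣ t) {m : ℤ[X]} (hm : aeval (π ^ k * T) m = 0) {j : ℕ} (hj : j < n) :
    (p : ℤ) ∣ m.coeff j := by
  induction j using Nat.strong_induction_on with
  | _ j ih =>
  have hdvd : π ^ (k * j + 1) ∣ π ^ (k * j) * ((m.coeff j : R) * T ^ j) := by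
    by_cases hjm : j ∈ range (m.natDegree + 1)
    · rw [aeval_eq_sum_range, ← add_sum_erase _ _ hjm] at hm
      have h1 : m.coeff j • (π ^ k * T) ^ j = π ^ (k * j) * ((m.coeff j : R) * T ^ j) := by
        rw [zsmul_eq_mul, mul_pow, ← pow_mul]; ring
      rw [← h1, eq_neg_of_add_eq_zero_left hm, dvd_neg]
      refine dvd_sum fun i hi => ?_
      rw [zsmul_eq_mul]
      rcases lt_or_gt_of_ne (ne_of_mem_erase hi) with h | h
      · have h2 := (Int.cast_dvd_cast (α := R) _ _ (ih i h (h.trans hj)))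
        rw [Int.cast_natCast] at h2
        exact (((pow_dvd_pow π (by nlinarith)).trans hp).trans h2).mul_right _
      · rw [mul_pow, ← pow_mul]
        exact ((pow_dvd_pow π (by nlinarith)).mul_right _).mul_left _
    · rw [coeff_eq_zero_of_natDegree_lt (by simpa using hjm)]
      simp
  rw [pow_succ, mul_dvd_mul_iff_left (pow_ne_zero _ hπ0)] at hdvd
  have h3 : π ∣ ((m.coeff j * t ^ j : ℤ) : R) := by
    have h4 := (hT.trans (sub_dvd_pow_sub_pow T (t : R) j)).mul_left (m.coeff j : R)
    push_cast
    convert! dvd_sub hdvd h4 using 1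
    ring
  have hp' : Prime (p : ℤ) := Nat.prime_iff_prime_int.1 Fact.out
  exact (hp'.dvd_or_dvd (hπp _ h3)).resolve_right fun h => ht (hp'.dvd_of_dvd_pow h)

open Polynomial Finset in
/-- Comparing two roots of an Eisenstein-like polynomial determines its linear coefficient. -/
theorem dvd_linear_coeff_sub {R : Type*} [CommRing R] [IsDomain R] {π u : R} (hπ0 : π ≠ 0)
    {p k n : ℕ} [Fact p.Prime] (hk : 0 < k) (hn : 2 ≤ n) (hp : (p : R) = π ^ (k * n) * u)
    (hu : π ∣ u + 1) (hπp : ∀ N : ℤ, π ∣ (N : R) → (p : ℤ) ∣ N) {A w w' : R} {a b z : ℤ}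
    (hA : π ∣ A - a) (ha : ¬ (p : ℤ) ∣ a) (hz : (p : ℤ) ∣ z ^ n - 1) (hz1 : ¬ (p : ℤ) ∣ z - 1)
    {m : ℤ[X]} (hmonic : m.Monic) (hdeg : m.natDegree ≤ n)
    (h1 : aeval (π ^ k * (A + b * π ^ k + π ^ (k + 1) * w)) m = 0)
    (h2 : aeval (π ^ k * (z * A + z ^ 2 * b * π ^ k + π ^ (k + 1) * w')) m = 0) :
    ∃ r, m.coeff 1 = p * r ∧ (p : ℤ) ∣ n * a ^ (n - 1) * b - r * a := by
  have hdvd {j : ℕ} (hj : j < n) : (p : ℤ) ∣ m.coeff j := by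
    refine dvd_coeff_of_root_eq_pow_mul hπ0 hk ⟨u, hp⟩ hπp ?_ ha h1 hj
    have : A + b * π ^ k + π ^ (k + 1) * w - a = (A - a) + π ^ k * (b + π * w) := by ring
    rw [this]
    exact dvd_add hA ((dvd_pow_self π hk.ne').mul_right _)
  have hp1 : ¬ (p : ℤ) ∣ 1 := (Nat.prime_iff_prime_int.1 (Fact.out : p.Prime)).not_dvd_one
  have hdeg' : m.natDegree = n := by
    refine le_antisymm hdeg (not_lt.1 fun h => hp1 ?_)
    simpa [hmonic.coeff_natDegree] using hdvd h
  obtain ⟨r, hr⟩ := hdvd (show 1 < n by lia)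
  refine ⟨r, hr, ?_⟩
  have hroot (T : R) (hT : aeval (π ^ k * T) m = 0) :
      π ^ (k * n + k + 1) ∣ π ^ (k * n) * (T ^ n + u * r * π ^ k * T) + m.coeff 0 := by
    obtain ⟨l, rfl⟩ : ∃ l, n = l + 2 := ⟨n - 2, by lia⟩
    rw [aeval_eq_sum_range, hdeg', sum_range_succ, sum_range_succ', sum_range_succ'] at hT
    rw [← hdeg', hmonic.coeff_natDegree, hdeg'] at hT
    simp only [zsmul_eq_mul, zero_add, hr, pow_zero, pow_one, Int.cast_mul, Int.cast_natCast, hp,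
      one_smul, mul_one, mul_pow, ← pow_mul] at hT
    have h3 : π ^ (k * (l + 2)) * (T ^ (l + 2) + u * r * π ^ k * T) + m.coeff 0 =
        -∑ i ∈ range l, (m.coeff (i + 1 + 1) : R) * (π ^ (k * (i + 1 + 1)) * T ^ (i + 1 + 1)) := by
      linear_combination hT
    rw [h3, dvd_neg]
    refine dvd_sum fun i hi => ?_
    rw [mem_range] at hi
    have h4 := Int.cast_dvd_cast (α := R) _ _ (hdvd (show i + 1 + 1 < l + 2 by lia))
    rw [Int.cast_natCast, hp] at h4
    have h5 : π ^ (k * (l + 2) + k + 1) ∣ π ^ (k * (l + 2)) * π ^ (k * (i + 1 + 1)) := by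
      rw [← pow_add]
      exact pow_dvd_pow π (by nlinarith)
    rw [← mul_assoc]
    exact (h5.trans (mul_dvd_mul_right ((dvd_mul_right _ _).trans h4) _)).mul_right _
  have h3 : π ^ (k + 1) ∣
      (z * A + z ^ 2 * b * π ^ k + π ^ (k + 1) * w') ^ n -
        (A + b * π ^ k + π ^ (k + 1) * w) ^ n + u * r * π ^ k *
        ((z * A + z ^ 2 * b * π ^ k + π ^ (k + 1) * w') - (A + b * π ^ k + π ^ (k + 1) * w)) := by
    have h4 := dvd_sub (hroot _ h2) (hroot _ h1)
    rw [add_assoc, pow_add, add_sub_add_right_eq_sub, ← mul_sub,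
      mul_dvd_mul_iff_left (pow_ne_zero _ hπ0)] at h4
    convert! h4 using 1
    ring
  have hzn : π ^ (k + 1) ∣ ((z ^ n - 1 : ℤ) : R) := by
    have h4 := Int.cast_dvd_cast (α := R) _ _ hz
    rw [Int.cast_natCast, hp] at h4
    exact ((pow_dvd_pow π (by nlinarith)).trans (dvd_mul_right _ _)).trans h4
  have hexp (x y v : R) : π ^ (k + 1) ∣
      (x + y * π ^ k + π ^ (k + 1) * v) ^ n - (x ^ n + n * x ^ (n - 1) * y * π ^ k) := by
    obtain ⟨e, he⟩ := powAddExpansion x (y * π ^ k + π ^ (k + 1) * v) n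
    have h5 : π ^ (2 * k) = π ^ (k + 1) * π ^ (k - 1) := by
      rw [← pow_add]; congr 1; lia
    rw [add_assoc, he]
    exact ⟨n * x ^ (n - 1) * v + e * π ^ (k - 1) * (y + π * v) ^ 2, by
      linear_combination e * (y + π * v) ^ 2 * h5⟩
  have h6 : π ^ (k + 1) ∣ π ^ k * ((z - 1) * (n * A ^ (n - 1) * b + u * r * A)) := by
    obtain ⟨e1, he1⟩ := hexp (z * A) (z ^ 2 * b) w'
    obtain ⟨e2, he2⟩ := hexp A b w
    obtain ⟨e3, he3⟩ := hzn
    obtain ⟨e4, he4⟩ := h3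
    have h5 : π ^ (2 * k) = π ^ (k + 1) * π ^ (k - 1) := by
      rw [← pow_add]; congr 1; lia
    obtain ⟨l, rfl⟩ : ∃ l, n = l + 1 := ⟨n - 1, by lia⟩
    rw [Nat.add_sub_cancel] at he1 he2 ⊢
    push_cast at he3
    refine ⟨e4 - e1 + e2 - e3 * (A ^ (l + 1) + (l + 1 : ℕ) * z * A ^ l * b * π ^ k) -
      u * r * (π ^ (k - 1) * (z ^ 2 * b - b) + π ^ k * (w' - w)), ?_⟩
    rw [mul_pow, mul_pow] at he1
    linear_combination he4 - he1 + he2 -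
      (A ^ (l + 1) + (l + 1 : ℕ) * z * A ^ l * b * π ^ k) * he3 - u * r * (z ^ 2 * b - b) * h5
  rw [pow_succ, mul_dvd_mul_iff_left (pow_ne_zero _ hπ0)] at h6
  have h7 : π ∣ (((z - 1) * (n * a ^ (n - 1) * b - r * a) : ℤ) : R) := by
    have h8 := hA.trans (sub_dvd_pow_sub_pow A (a : R) (n - 1))
    obtain ⟨e1, he1⟩ := hA
    obtain ⟨e2, he2⟩ := h8
    obtain ⟨e3, he3⟩ := hu
    obtain ⟨e4, he4⟩ := h6
    push_cast
    refine ⟨e4 - (z - 1) * (n * e2 * b + e3 * r * A - r * e1), ?_⟩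
    linear_combination he4 - (z - 1) * (n * b * he2 + r * A * he3 - r * he1)
  exact ((Nat.prime_iff_prime_int.1 (Fact.out : p.Prime)).dvd_or_dvd (hπp _ h7)).resolve_left hz1

open Finset in
theorem IsPrimitiveRoot.exists_natCast_eq_sub_one_pow_mul {R : Type*} [CommRing R] [IsDomain R]
    {p : ℕ} [Fact p.Prime] (hodd : Odd p) {ζ : R} (hζ : IsPrimitiveRoot ζ p) :
    ∃ u : R, IsUnit u ∧ (p : R) = (ζ - 1) ^ (p - 1) * u ∧ ζ - 1 ∣ u + 1 := by
  have hp : p.Prime := Fact.out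
  have hp1 : p - 1 + 1 = p := by have := hp.pos; lia
  have hprod := prod_pow_sub_one_eq_order (n := p - 1) (μ := ζ) (by rwa [hp1])
  have heven : Even (p - 1) := by obtain ⟨t, rfl⟩ := hodd; simp
  rw [heven.neg_one_pow, one_mul, ← Nat.cast_add_one, hp1] at hprod
  have hgeom : (p : R) = (ζ - 1) ^ (p - 1) *
      ∏ i ∈ range (p - 1), ∑ l ∈ range (i + 1), ζ ^ l := by
    simp_rw [← hprod, ← mul_geom_sum]
    rw [prod_mul_distrib, prod_const, card_range]
  refine ⟨_, ?_, hgeom, ?_⟩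
  · refine IsUnit.prod_iff.2 fun i hi => hζ.geom_sum_isUnit hp.two_le ?_
    rw [mem_range] at hi
    exact (Nat.coprime_of_lt_prime (by lia) (by lia) hp).symm
  · have hdvd : ζ - 1 ∣ (((p - 1).factorial : ℤ) + 1 : R) := by
      have h1 : (p : ℤ) ∣ (p - 1).factorial + 1 := by
        rw [← ZMod.intCast_zmod_eq_zero_iff_dvd _ p]
        push_cast
        rw [ZMod.wilsons_lemma, neg_add_cancel]
      have h2 := Int.cast_dvd_cast (α := R) _ _ h1
      push_cast at h2 ⊢
      exact (hζ.sub_one_dvd_natCast hp.one_lt).trans h2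
    rw [← Ideal.mem_span_singleton, ← Ideal.Quotient.eq_zero_iff_mem] at hdvd ⊢
    have hone : Ideal.Quotient.mk (Ideal.span {ζ - 1}) ζ = 1 := by
      rw [← sub_eq_zero, ← map_one (Ideal.Quotient.mk _), ← map_sub]
      exact Ideal.Quotient.eq_zero_iff_mem.2 (Ideal.mem_span_singleton_self _)
    rw [← hdvd]
    simp only [map_add, map_prod, map_sum, map_pow, hone, one_pow, map_one, map_intCast]
    simp only [sum_const, card_range, nsmul_eq_mul, mul_one, ← Finset.prod_range_add_one_eq_factorial]
    push_cast
    rfl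

theorem not_isUnit_natCast_integralClosure {p : ℕ} (hp : p.Prime) :
    ¬ IsUnit (p : integralClosure ℤ ℂ) := by
  intro h
  obtain ⟨x, hx⟩ := h.exists_right_inv
  have hx' : (p : ℂ) * x = 1 := by exact_mod_cast congrArg Subtype.val hx
  have hxq : (x : ℂ) = algebraMap ℚ ℂ (1 / p) := by
    have : (p : ℂ) ≠ 0 := by exact_mod_cast hp.ne_zero
    simp only [map_div₀, map_one, map_natCast]
    field_simp
    linear_combination hx'
  have hint : IsIntegral ℤ (1 / p : ℚ) := by
    have := x.2
    rw [mem_integralClosure_iff, hxq] at this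
    exact (isIntegral_algebraMap_iff (algebraMap ℚ ℂ).injective).1 this
  obtain ⟨y, hy⟩ := IsIntegrallyClosed.isIntegral_iff.1 hint
  have hp0 : (p : ℚ) ≠ 0 := by exact_mod_cast hp.ne_zero
  rw [eq_intCast, eq_div_iff hp0] at hy
  have : y * (p : ℤ) = 1 := by exact_mod_cast hy
  exact (Nat.prime_iff_prime_int.1 hp).not_dvd_one ⟨y, by rw [mul_comm, this]⟩

theorem dvd_of_sub_one_dvd_intCast {p : ℕ} [Fact p.Prime] (hodd : Odd p)
    {ζ : integralClosure ℤ ℂ} (hζ : IsPrimitiveRoot ζ p) {N : ℤ}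
    (hN : ζ - 1 ∣ (N : integralClosure ℤ ℂ)) : (p : ℤ) ∣ N := by
  have hp : p.Prime := Fact.out
  by_contra h
  obtain ⟨s, t, hst⟩ := ((Nat.prime_iff_prime_int.1 hp).coprime_iff_not_dvd.2 h)
  obtain ⟨u, hu, hpu, -⟩ := hζ.exists_natCast_eq_sub_one_pow_mul hodd
  have hunit : ζ - 1 ∣ 1 := by
    have : ((s * p + t * N : ℤ) : integralClosure ℤ ℂ) = 1 := by rw [hst, Int.cast_one]
    push_cast at this
    exact (dvd_add ((hζ.sub_one_dvd_natCast hp.one_lt).mul_left (s : integralClosure ℤ ℂ))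
      (hN.mul_left (t : integralClosure ℤ ℂ))).trans this.dvd
  refine not_isUnit_natCast_integralClosure hp ?_
  rw [hpu]
  exact ((isUnit_of_dvd_one hunit).pow _).mul hu

open Finset in
/-- The element `∑_{y ∈ U_k} (ζ ^ (c y) - 1)`. -/
def gaussPeriod {R : Type*} [CommRing R] {p : ℕ} [NeZero p] (k : ℕ) (ζ : R) (c : ZMod p) : R :=
  ∑ y ∈ univ.filter (fun y : ZMod p => y ^ k = 1), (ζ ^ (c * y).val - 1)

section gaussPeriod

variable {R : Type*} [CommRing R] {p : ℕ} [Fact p.Prime] {k : ℕ}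

theorem map_gaussPeriod {S : Type*} [CommRing S] (f : R →+* S) (ζ : R) (c : ZMod p) :
    f (gaussPeriod k ζ c) = gaussPeriod k (f ζ) c := by
  simp [gaussPeriod]

theorem gaussPeriod_eq_of_pow_eq (hk : 0 < k) (ζ : R) {c d : ZMod p} (h : c ^ k = d ^ k) :
    gaussPeriod k ζ c = gaussPeriod k ζ d := by
  rcases eq_or_ne d 0 with rfl | hd
  · rw [zero_pow hk.ne'] at h
    rw [eq_zero_of_pow_eq_zero h]
  have he : (c / d) ^ k = 1 := by rw [div_pow, h, div_self (pow_ne_zero k hd)]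
  have he0 : c / d ≠ 0 := by
    intro h0
    rw [h0, zero_pow hk.ne'] at he
    exact zero_ne_one he
  refine Finset.sum_bijective (c / d * ·) (mulLeft_bijective₀ _ he0) (fun y => ?_) fun y _ => ?_
  · simp [mul_pow, he]
  · rw [← mul_assoc, mul_div_cancel₀ _ hd]

theorem gaussPeriod_pow {ζ : R} (hζ : ζ ^ p = 1) (c d : ZMod p) :
    gaussPeriod k (ζ ^ c.val) d = gaussPeriod k ζ (c * d) := by
  refine Finset.sum_congr rfl fun y _ => ?_
  rw [← pow_mul, mul_assoc, ZMod.val_mul c, ← pow_eq_pow_mod _ hζ]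

theorem eq_pow_val_of_pow_eq_one [IsDomain R] {ζ ξ : R} (hζ : IsPrimitiveRoot ζ p)
    (hξ : ξ ^ p = 1) : ∃ c : ZMod p, ξ = ζ ^ c.val := by
  obtain ⟨i, hi, rfl⟩ := hζ.eq_pow_of_pow_eq_one hξ
  exact ⟨i, by rw [ZMod.val_cast_of_lt hi]⟩

open Polynomial in
theorem aeval_minpoly_gaussPeriod {ζ : ℂ} (hζ : IsPrimitiveRoot ζ p) {c : ZMod p} (hc : c ≠ 0) :
    aeval (gaussPeriod k ζ c) (minpoly ℤ (gaussPeriod k ζ (1 : ZMod p))) = 0 := by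
  have hp : p.Prime := Fact.out
  let f : ℤ[X] := gaussPeriod k X (1 : ZMod p)
  have hf (ξ : ℂ) : aeval ξ f = gaussPeriod k ξ (1 : ZMod p) := by
    have := map_gaussPeriod (k := k) (aeval (R := ℤ) ξ).toRingHom X (1 : ZMod p)
    simpa using this
  have hroot : aeval ζ ((minpoly ℤ (gaussPeriod k ζ (1 : ZMod p))).comp f) = 0 := by
    rw [aeval_comp, hf, minpoly.aeval]
  have hdvd := minpoly.isIntegrallyClosed_dvd (hζ.isIntegral hp.pos) hroot
  have hζc : IsPrimitiveRoot (ζ ^ c.val) p := by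
    refine hζ.pow_of_coprime _ ((Nat.coprime_of_lt_prime ?_ (ZMod.val_lt c) hp).symm)
    exact (ZMod.val_ne_zero c).2 hc
  rw [← cyclotomic_eq_minpoly hζ hp.pos, cyclotomic_eq_minpoly hζc hp.pos] at hdvd
  have := aeval_eq_zero_of_dvd_aeval_eq_zero hdvd (minpoly.aeval ℤ (ζ ^ c.val))
  rwa [aeval_comp, hf, gaussPeriod_pow hζ.pow_eq_one, mul_one] at this

theorem isIntegral_gaussPeriod {ζ : ℂ} (hζ : IsPrimitiveRoot ζ p) (c : ZMod p) :
    IsIntegral ℤ (gaussPeriod k ζ c) :=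
  IsIntegral.sum _ fun _ _ => ((hζ.isIntegral (Fact.out : p.Prime).pos).pow _).sub isIntegral_one

open Polynomial IntermediateField in
theorem natDegree_minpoly_gaussPeriod_le {n : ℕ} (hk : 0 < k) (hn : 0 < n) (hkn : k * n = p - 1)
    {ζ : ℂ} (hζ : IsPrimitiveRoot ζ p) :
    (minpoly ℚ (gaussPeriod k ζ (1 : ZMod p))).natDegree ≤ n := by
  have hp : p.Prime := Fact.out
  have hζint : IsIntegral ℚ ζ := (hζ.isIntegral hp.pos).tower_top
  have : FiniteDimensional ℚ ℚ⟮ζ⟯ := adjoin.finiteDimensional hζint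
  have hgen : algebraMap ℚ⟮ζ⟯ ℂ (gaussPeriod k (AdjoinSimple.gen ℚ ζ) (1 : ZMod p)) =
      gaussPeriod k ζ (1 : ZMod p) := by
    rw [map_gaussPeriod, AdjoinSimple.algebraMap_gen]
  have hgenp : AdjoinSimple.gen ℚ ζ ^ p = 1 := by
    apply (algebraMap ℚ⟮ζ⟯ ℂ).injective
    rw [map_pow, AdjoinSimple.algebraMap_gen, hζ.pow_eq_one, map_one]
  rw [← hgen, minpoly.algebraMap_eq (algebraMap ℚ⟮ζ⟯ ℂ).injective]
  set θ := gaussPeriod k (AdjoinSimple.gen ℚ ζ) (1 : ZMod p)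
  have hirr := minpoly.irreducible (Algebra.IsIntegral.isIntegral (R := ℚ) θ)
  rw [← card_rootSet_eq_natDegree (K := ℂ) hirr.separable (IsAlgClosed.splits _),
    ← Set.toFinset_card]
  let h : ZMod p → ℂ := Function.extend (fun c : ZMod p => c ^ k) (gaussPeriod k ζ) 0
  have hh (c : ZMod p) : h (c ^ k) = gaussPeriod k ζ c :=
    Function.FactorsThrough.extend_apply (f := fun c : ZMod p => c ^ k)
      (fun c d hcd => gaussPeriod_eq_of_pow_eq hk ζ hcd) 0 c
  have hsub : ((minpoly ℚ θ).rootSet ℂ).toFinset ⊆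
      (nthRootsFinset n (1 : ZMod p)).image h := by
    intro x hx
    rw [Set.mem_toFinset, ← Algebra.IsAlgebraic.range_eval_eq_rootSet_minpoly] at hx
    obtain ⟨ψ, rfl⟩ := hx
    obtain ⟨c, hc⟩ := eq_pow_val_of_pow_eq_one hζ (ξ := ψ (AdjoinSimple.gen ℚ ζ))
      (by rw [← map_pow, hgenp, map_one])
    have hc0 : c ≠ 0 := by
      rintro rfl
      rw [ZMod.val_zero, pow_zero, ← map_one ψ] at hc
      have h1 := congrArg (algebraMap ℚ⟮ζ⟯ ℂ) (ψ.injective hc)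
      rw [AdjoinSimple.algebraMap_gen, map_one] at h1
      exact hζ.ne_one hp.one_lt h1
    refine Finset.mem_image.2 ⟨c ^ k, ?_, ?_⟩
    · rw [mem_nthRootsFinset hn, ← pow_mul, hkn, ZMod.pow_card_sub_one_eq_one hc0]
    · rw [hh]
      have := map_gaussPeriod (k := k) ψ.toRingHom (AdjoinSimple.gen ℚ ζ) (1 : ZMod p)
      simp only [AlgHom.toRingHom_eq_coe, RingHom.coe_coe, hc, gaussPeriod_pow hζ.pow_eq_one,
        mul_one] at this
      exact this.symm
  refine (Finset.card_le_card hsub).trans (Finset.card_image_le.trans ?_)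
  rw [nthRootsFinset_def]
  exact (Multiset.toFinset_card_le _).trans (card_nthRoots n 1)

end gaussPeriod

theorem one_le_padicValRat_add_one_div {p D : ℕ} [Fact p.Prime] {r : ℤ} (hD : 1 < D)
    (hpD : ¬ p ∣ D) (h : (p : ℤ) ∣ r * D + 1) : 1 ≤ padicValRat p (r + 1 / D : ℚ) := by
  have hD0 : (D : ℚ) ≠ 0 := by exact_mod_cast (by lia : D ≠ 0)
  have hne : r * D + 1 ≠ 0 := by
    intro h0
    have : (D : ℤ) ∣ 1 := ⟨-r, by linear_combination h0⟩
    have := Int.le_of_dvd one_pos this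
    lia
  have heq : (r + 1 / D : ℚ) = ((r * D + 1 : ℤ) : ℚ) / (D : ℤ) := by
    push_cast
    field_simp
  have hD0' : ((D : ℤ) : ℚ) ≠ 0 := by exact_mod_cast hD0
  rw [heq, padicValRat.div (by exact_mod_cast hne) hD0', padicValRat.of_int, padicValRat.of_int,
    padicValInt.of_nat, padicValNat.eq_zero_of_not_dvd hpD]
  have := (padicValInt_dvd_iff 1 (r * D + 1)).1 (by simpa using h)
  have : 1 ≤ padicValInt p (r * D + 1) := this.resolve_left hne
  lia

/-- The linear coefficient of the minimal polynomial over `ℤ` of a Gaussian period. -/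
theorem exists_coeff_one_minpoly_gaussPeriod {p k n : ℕ} [Fact p.Prime] (hodd : Odd p)
    (hk : 0 < k) (hn : 2 ≤ n) (hkn : k * n = p - 1) {ζ : ℂ} (hζ : IsPrimitiveRoot ζ p) :
    ∃ r : ℤ, (minpoly ℤ (gaussPeriod k ζ (1 : ZMod p))).coeff 1 = p * r ∧
      (r : ZMod p) * (((k - 1).factorial : ZMod p) ^ (n - 2) * ((2 * k).factorial : ZMod p)) =
        -1 := by
  have hp : p.Prime := Fact.out
  have hp2 := hp.two_le
  have hkp : 2 * k < p := by
    have := Nat.mul_le_mul_left k hn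
    lia
  have hkd : k ∣ p - 1 := ⟨n, hkn.symm⟩
  have hfac {j : ℕ} (hj : j < p) : (j.factorial : ZMod p) ≠ 0 := by
    rw [Ne, ZMod.natCast_eq_zero_iff, hp.dvd_factorial]
    exact hj.not_ge
  obtain ⟨a, ha⟩ := ZMod.intCast_surjective ((k - 1).factorial : ZMod p)⁻¹
  obtain ⟨b, hb⟩ := ZMod.intCast_surjective ((k : ZMod p) * ((2 * k).factorial : ZMod p)⁻¹)
  obtain ⟨c, hc⟩ := ZMod.exists_isPrimitiveRoot (p := p) (k := p - 1) dvd_rfl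
  have hc0 : c ≠ 0 := hc.ne_zero (by lia)
  obtain ⟨z, hz⟩ := ZMod.intCast_surjective (c ^ k)
  let ξ : integralClosure ℤ ℂ := ⟨ζ, hζ.isIntegral hp.pos⟩
  have hξ : IsPrimitiveRoot ξ p :=
    IsPrimitiveRoot.of_map_of_injective (f := (integralClosure ℤ ℂ).val) hζ Subtype.val_injective
  obtain ⟨u, -, hpu, hu1⟩ := hξ.exists_natCast_eq_sub_one_pow_mul hodd
  obtain ⟨A, hA, hexp⟩ := exists_gaussPeriod_expansion hk hkd hkp
    (π := ξ - 1) (by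
      rw [hpu, mul_right_comm, ← pow_succ, Nat.sub_add_cancel (by lia)]
      exact dvd_mul_right _ _) ha hb
  obtain ⟨w, hw⟩ := hexp 1 1 (by simp)
  obtain ⟨w', hw'⟩ := hexp c z hz
  have hroot {c : ZMod p} (hc : c ≠ 0) :
      Polynomial.aeval (gaussPeriod k ξ c) (minpoly ℤ (gaussPeriod k ζ (1 : ZMod p))) = 0 := by
    rw [← Polynomial.aeval_algebraMap_eq_zero_iff (B := ℂ), map_gaussPeriod]
    exact aeval_minpoly_gaussPeriod hζ hc
  have h1 := hroot (one_ne_zero (α := ZMod p))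
  have h2 := hroot hc0
  unfold gaussPeriod at h1 h2
  rw [add_sub_cancel] at hw hw'
  rw [hw, Int.cast_one, one_mul, one_pow, one_mul] at h1
  rw [hw'] at h2
  have hθ : IsIntegral ℤ (gaussPeriod k ζ (1 : ZMod p)) := isIntegral_gaussPeriod hζ 1
  have hdeg : (minpoly ℤ (gaussPeriod k ζ (1 : ZMod p))).natDegree ≤ n := by
    have := natDegree_minpoly_gaussPeriod_le hk (by lia) hkn hζ
    rwa [minpoly.isIntegrallyClosed_eq_field_fractions' ℚ hθ,
      (minpoly.monic hθ).natDegree_map] at this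
  have hpu' : (p : integralClosure ℤ ℂ) = (ξ - 1) ^ (k * n) * u := by rw [hkn, hpu]
  obtain ⟨r, hr, hra⟩ := dvd_linear_coeff_sub (sub_ne_zero.2 (hξ.ne_one hp.one_lt)) hk hn hpu' hu1
    (fun N => dvd_of_sub_one_dvd_intCast hodd hξ) hA
    (by
      rw [← ZMod.intCast_zmod_eq_zero_iff_dvd, ha]
      exact inv_ne_zero (hfac (by lia)))
    (by
      rw [← ZMod.intCast_zmod_eq_zero_iff_dvd]
      push_cast
      rw [hz, ← pow_mul, hkn, hc.pow_eq_one, sub_self])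
    (by
      rw [← ZMod.intCast_zmod_eq_zero_iff_dvd]
      push_cast
      rw [hz, sub_eq_zero]
      exact hc.pow_ne_one_of_pos_of_lt hk.ne' (by lia))
    (minpoly.monic hθ) hdeg h1 h2
  refine ⟨r, hr, ?_⟩
  rw [← ZMod.intCast_zmod_eq_zero_iff_dvd] at hra
  push_cast at hra
  rw [ha, hb] at hra
  have hnk : (k : ZMod p) * n = -1 := by
    rw [← Nat.cast_mul, hkn, Nat.cast_sub (by lia)]
    simp
  have hF := hfac (show k - 1 < p by lia)
  have hG := hfac hkp
  obtain ⟨l, rfl⟩ : ∃ l, n = l + 2 := ⟨n - 2, by lia⟩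
  rw [show l + 2 - 1 = l + 1 by lia, pow_succ, sub_eq_zero, inv_pow] at hra
  rw [Nat.add_sub_cancel]
  generalize ((k - 1).factorial : ZMod p) = F at *
  generalize ((2 * k).factorial : ZMod p) = G at *
  rw [← hnk]
  field_simp at hra
  linear_combination -hra

/-- `a_p(k)/p ≡ -(1/(k-1)!)^{n-2} · (1/(2k)!) (mod p)`, i.e. the `p`-adic
valuation of `a_p(k)/p + 1/((k-1)!^{n-2} · (2k)!)` is at least `1`, where `n = (p-1)/k`
and `a_p(k)` is the coefficient of `t` in the minimal polynomial over `ℚ` of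
`θ_k = ∑_{y ∈ U_k} (ζ_p^y - 1)`. -/
theorem apk_congruence (p : ℕ) [Fact p.Prime] (hp : Odd p)
    (k : ℕ) (hk1 : 1 ≤ k) (hk2 : k < p - 1) (hkd : k ∣ p - 1)
    (n : ℕ) (hn : n = (p - 1) / k)
    (ζ : ℂ) (hζ : ζ = Complex.exp (2 * Real.pi * Complex.I / p))
    (θ : ℂ)
    (hθ : θ = ∑ y ∈ Finset.univ.filter (fun y : ZMod p => y ^ k = 1), (ζ ^ y.val - 1))
    (a : ℚ) (ha : a = (minpoly ℚ θ).coeff 1) :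
    1 ≤ padicValRat p
      (a / p + 1 / (((k - 1).factorial : ℚ) ^ (n - 2) * ((2 * k).factorial : ℚ))) := by
  have hpp : p.Prime := Fact.out
  have hkn : k * n = p - 1 := by rw [hn, Nat.mul_div_cancel' hkd]
  have hn2 : 2 ≤ n := by
    by_contra! h
    interval_cases n <;> lia
  have hζ' : IsPrimitiveRoot ζ p := hζ ▸ Complex.isPrimitiveRoot_exp p hpp.ne_zero
  have hθ' : θ = gaussPeriod k ζ (1 : ZMod p) := by simp [hθ, gaussPeriod]
  obtain ⟨r, hr, hrD⟩ := exists_coeff_one_minpoly_gaussPeriod hp hk1 hn2 hkn hζ'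
  have hp0 : (p : ℚ) ≠ 0 := by exact_mod_cast hpp.ne_zero
  have har : a / p = r := by
    rw [ha, hθ', minpoly.isIntegrallyClosed_eq_field_fractions' ℚ (isIntegral_gaussPeriod hζ' 1),
      Polynomial.coeff_map, hr]
    simp [hp0]
  have hkp : 2 * k < p := by
    have := Nat.mul_le_mul_left k hn2
    lia
  rw [har]
  have h2 : 2 ≤ (2 * k).factorial :=
    (show 2 ≤ 2 * k by lia).trans (Nat.self_le_factorial _)
  have hD : 1 < (k - 1).factorial ^ (n - 2) * (2 * k).factorial :=
    lt_of_lt_of_le h2 (Nat.le_mul_of_pos_left _ (pow_pos (Nat.factorial_pos _) _))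
  have hpD : ¬ p ∣ (k - 1).factorial ^ (n - 2) * (2 * k).factorial := by
    rw [hpp.dvd_mul, not_or, hpp.dvd_factorial]
    exact ⟨fun h => absurd (hpp.dvd_factorial.1 (hpp.dvd_of_dvd_pow h)) (by lia), by lia⟩
  have h := one_le_padicValRat_add_one_div (r := r) hD hpD (by
    rw [← ZMod.intCast_zmod_eq_zero_iff_dvd]
    push_cast
    rw [hrD, neg_add_cancel])
  exact_mod_cast h
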